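/- arXiv:2002.07014 — 3 statements merged into one kernel-verified Lean document; each statement's English description precedes it below -/
import Mathlib

section
/- For every non-negative integer n, the sum over k from 0 to n of s(n,k)·B_k equals (-1)^n · n!/(n+1), where s(n,k) are the (signed) Stirling numbers of the first kind and B_k are the Bernoulli numbers. -/
open Polynomial in
/-- The linear functional on polynomials sending `X ^ k` to the Bernoulli number `B_k`. -/
noncomputable def bernoulliFunctional : ℚ[X] →ₗ[ℚ] ℚ :=
  Polynomial.lsum fun k => LinearMap.mulRight ℚ (_root_.bernoulli k)

open Polynomial in
theorem bernoulliFunctional_apply (p : ℚ[X]) :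
    bernoulliFunctional p = p.sum fun k a => a * _root_.bernoulli k := rfl

open Polynomial in
theorem bernoulliFunctional_X_pow (k : ℕ) : bernoulliFunctional (X ^ k) = _root_.bernoulli k := by
  rw [bernoulliFunctional_apply, ← monomial_one_right_eq_X_pow, sum_monomial_index _ _ (by simp),
    one_mul]

open Polynomial in
theorem bernoulliFunctional_comp_X_add_one (p : ℚ[X]) :
    bernoulliFunctional (p.comp (X + 1)) = bernoulliFunctional p + p.coeff 1 := by
  induction p using Polynomial.induction_on' with
  | add p q hp hq => simp only [add_comp, map_add, hp, hq, coeff_add]; ring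
  | monomial n a =>
    have h : bernoulliFunctional ((X + 1) ^ n) = _root_.bernoulli n + if n = 1 then 1 else 0 := by
      have hterm (k : ℕ) : bernoulliFunctional (X ^ k * 1 ^ (n - k) * (n.choose k : ℚ[X])) =
          n.choose k * _root_.bernoulli k := by
        rw [one_pow, mul_one, mul_comm, ← nsmul_eq_mul, map_nsmul, bernoulliFunctional_X_pow,
          nsmul_eq_mul]
      rw [add_pow, map_sum, Finset.sum_congr rfl fun k _ => hterm k, Finset.sum_range_succ,
        _root_.sum_bernoulli, Nat.choose_self, Nat.cast_one, one_mul, add_comm]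
    rw [← smul_X_eq_monomial, smul_comp, X_pow_comp, map_smul, map_smul, h,
      bernoulliFunctional_X_pow, coeff_smul, coeff_X_pow]
    simp only [smul_eq_mul, eq_comm (a := 1)]
    ring

open Polynomial in
theorem descPochhammer_eval_neg_one (n : ℕ) :
    (descPochhammer ℚ n).eval (-1) = (-1) ^ n * (Nat.factorial n : ℚ) := by
  induction n with
  | zero => simp
  | succ n ih =>
    rw [descPochhammer_succ_eval, ih, Nat.factorial_succ]
    push_cast
    ring

open Polynomial in
theorem descPochhammer_succ_coeff_one (n : ℕ) :
    (descPochhammer ℚ (n + 1)).coeff 1 = (-1) ^ n * (Nat.factorial n : ℚ) := by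
  rw [descPochhammer_succ_left, coeff_X_mul, coeff_zero_eq_eval_zero, eval_comp]
  simpa using descPochhammer_eval_neg_one n

open Polynomial in
theorem descPochhammer_succ_comp_X_add_one (n : ℕ) :
    (descPochhammer ℚ (n + 1)).comp (X + 1) =
      descPochhammer ℚ (n + 1) + (n + 1 : ℚ) • descPochhammer ℚ n := by
  have h := congrArg (fun p => p.comp (X + 1)) (descPochhammer_succ_comp_X_sub_one (R := ℚ) n)
  simp only [smul_eq_mul, comp_assoc, sub_comp, mul_comp, add_comp, natCast_comp, X_comp,
    one_comp, add_sub_cancel_right, comp_X] at h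
  rw [smul_eq_C_mul, C_add, C_1, C_eq_natCast]
  linear_combination -h

/-- For every non-negative integer `n`,
`∑_{k=0}^n s(n,k) · B_k = (-1)^n · n! / (n+1)`, where `s(n,k)` is the signed
Stirling number of the first kind (the coefficient of `x^k` in the falling
factorial `x(x-1)⋯(x-n+1)`) and `B_k` is the Bernoulli number (generating
function `t/(e^t - 1)`). -/
theorem stirling_bernoulli_sum (n : ℕ) :
    ∑ k ∈ Finset.range (n + 1), (descPochhammer ℚ n).coeff k * bernoulli k =
      (-1) ^ n * (Nat.factorial n : ℚ) / (n + 1) := by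
  have h := bernoulliFunctional_comp_X_add_one (descPochhammer ℚ (n + 1))
  rw [descPochhammer_succ_comp_X_add_one, map_add, add_right_inj, map_smul, smul_eq_mul,
    descPochhammer_succ_coeff_one, bernoulliFunctional_apply,
    Polynomial.sum_over_range' _ (by simp) (n + 1) (by simp [descPochhammer_natDegree])] at h
  rw [eq_div_iff (by positivity), mul_comm]
  exact h
end

section
/- For every non-negative integer n, the sum over k from 0 to n of s(n,k)·(2^{-k} - 2)·B_{k+1}/(k+1) equals (-1)^n/(n+1) · (1·3·5⋯(2n-1))/2^{n+1}, i.e., (-1)^n/(n+1) · (2n-1)!!/2^{n+1}, where s(n,k) are the (signed) Stirling numbers of the first kind and B_k are the Bernoulli numbers (with the empty product 1·3⋯(2n-1) interpreted as 1 when n = 0). -/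
open Polynomial in
/-- The duplication formula for Bernoulli polynomials at `0`:
`B_n(1/2) + B_n = 2^{1-n} B_n`. -/
theorem Polynomial.bernoulli_eval_half_add (n : ℕ) :
    (Polynomial.bernoulli n).eval (1 / 2 : ℚ) + _root_.bernoulli n =
      2 * (1 / 2 : ℚ) ^ n * _root_.bernoulli n := by
  have hG := Polynomial.bernoulli_generating_function (1 / 2 : ℚ)
  have hF := bernoulliPowerSeries_mul_exp_sub_one ℚ
  have hE : PowerSeries.rescale (1 / 2 : ℚ) (PowerSeries.exp ℚ) *
      PowerSeries.rescale (1 / 2 : ℚ) (PowerSeries.exp ℚ) = PowerSeries.exp ℚ := by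
    rw [PowerSeries.exp_mul_exp_eq_exp_add]
    norm_num
  have hH := congrArg (PowerSeries.rescale (1 / 2 : ℚ)) hF
  rw [map_mul, map_sub, map_one, PowerSeries.rescale_X] at hH
  have hC : (2 : PowerSeries ℚ) * PowerSeries.C (1 / 2 : ℚ) = 1 := by
    rw [← map_ofNat (PowerSeries.C (R := ℚ)) 2, ← map_mul]
    norm_num
  have hne : PowerSeries.exp ℚ - 1 ≠ 0 := by
    intro h
    rw [h, mul_zero] at hF
    exact PowerSeries.X_ne_zero hF.symm
  set E := PowerSeries.rescale (1 / 2 : ℚ) (PowerSeries.exp ℚ)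
  set G := PowerSeries.mk fun n =>
    aeval (1 / 2 : ℚ) ((1 / (n.factorial : ℚ)) • Polynomial.bernoulli n) with hGdef
  have key : G + bernoulliPowerSeries ℚ =
      2 * PowerSeries.rescale (1 / 2 : ℚ) (bernoulliPowerSeries ℚ) := by
    apply mul_right_cancel₀ hne
    linear_combination hG + hF - 2 * (E + 1) * hH - PowerSeries.X * (E + 1) * hC +
      2 * PowerSeries.rescale (1 / 2 : ℚ) (bernoulliPowerSeries ℚ) * hE
  have h := congrArg (PowerSeries.coeff n) key
  rw [← map_ofNat (PowerSeries.C (R := ℚ)) 2, PowerSeries.coeff_C_mul, map_add,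
    PowerSeries.coeff_rescale, hGdef, bernoulliPowerSeries, PowerSeries.coeff_mk,
    PowerSeries.coeff_mk] at h
  have hn : (n.factorial : ℚ) ≠ 0 := by positivity
  simp only [map_smul, smul_eq_mul, coe_aeval_eq_eval, Algebra.algebraMap_self,
    RingHom.id_apply] at h
  field_simp at h ⊢
  linear_combination h

/-- Summation of falling factorials. -/
theorem sum_range_descPochhammer_eval (n m : ℕ) :
    ∑ i ∈ Finset.range m, (descPochhammer ℚ n).eval (i : ℚ) =
      (descPochhammer ℚ (n + 1)).eval (m : ℚ) / (n + 1) := by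
  have hn : (n + 1 : ℚ) ≠ 0 := by positivity
  induction m with
  | zero => simp [descPochhammer_ne_zero_eval_zero]
  | succ m ih =>
    rw [Finset.sum_range_succ, ih]
    have h : (descPochhammer ℚ (n + 1)).eval ((m + 1 : ℕ) : ℚ) =
        (m + 1) * (descPochhammer ℚ n).eval (m : ℚ) := by
      simp [descPochhammer_succ_left]
    rw [h, descPochhammer_succ_eval]
    field_simp
    ring

open Polynomial in
/-- The indefinite sum of the falling factorial of degree `n`, expanded in Bernoulli polynomials. -/
theorem sum_coeff_descPochhammer_mul_bernoulli_sub (n : ℕ) (x : ℚ) :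
    ∑ k ∈ Finset.range (n + 1), (descPochhammer ℚ n).coeff k *
        ((Polynomial.bernoulli (k + 1)).eval x - _root_.bernoulli (k + 1)) / (k + 1) =
      (descPochhammer ℚ (n + 1)).eval x / (n + 1) := by
  have key : ∑ k ∈ Finset.range (n + 1), C ((descPochhammer ℚ n).coeff k / (k + 1)) *
      (Polynomial.bernoulli (k + 1) - C (_root_.bernoulli (k + 1))) =
      C (1 / (n + 1 : ℚ)) * descPochhammer ℚ (n + 1) := by
    apply Polynomial.eq_of_infinite_eval_eq
    refine (Set.infinite_range_of_injective (Nat.cast_injective (R := ℚ))).mono ?_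
    rintro _ ⟨m, rfl⟩
    simp only [Set.mem_ofPred_eq, eval_finsetSum, eval_mul, eval_sub, eval_C]
    rw [one_div_mul_eq_div, ← sum_range_descPochhammer_eval]
    simp only [eval_eq_sum_range (p := descPochhammer ℚ n), descPochhammer_natDegree]
    rw [Finset.sum_comm]
    simp only [← Finset.mul_sum]
    refine Finset.sum_congr rfl fun k _ => ?_
    have hk : (k + 1 : ℚ) ≠ 0 := by positivity
    rw [← Nat.succ_eq_add_one, ← sum_range_pow_eq_bernoulli_sub]
    field_simp
  have h := congrArg (eval x) key
  simp only [eval_finsetSum, eval_mul, eval_sub, eval_C] at h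
  rw [div_eq_mul_one_div, mul_comm, ← h]
  exact Finset.sum_congr rfl fun k _ => by ring

/-- The value at `1/2` of a falling factorial. -/
theorem descPochhammer_succ_eval_half (n : ℕ) :
    (descPochhammer ℚ (n + 1)).eval (1 / 2 : ℚ) =
      (-1) ^ n * (∏ i ∈ Finset.range n, (2 * (i : ℚ) + 1)) / 2 ^ (n + 1) := by
  induction n with
  | zero => simp
  | succ n ih =>
    rw [descPochhammer_succ_eval, ih, Finset.prod_range_succ]
    push_cast
    field_simp
    ring

/-- For every non-negative integer `n`,
`∑_{k=0}^n s(n,k) · (2^{-k} - 2) · B_{k+1}/(k+1)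
  = (-1)^n/(n+1) · (1·3·5⋯(2n-1))/2^{n+1}`,
where `s(n,k)` is the signed Stirling number of the first kind and `B_k` is the
Bernoulli number (generating function `t/(e^t - 1)`); the product
`1·3⋯(2n-1)` of the first `n` odd positive integers is `1` when `n = 0`. -/
theorem stirling_bernoulli_half_sum (n : ℕ) :
    ∑ k ∈ Finset.range (n + 1),
        (descPochhammer ℚ n).coeff k * ((2 : ℚ) ^ (-(k : ℤ)) - 2) *
          bernoulli (k + 1) / (k + 1) =
      (-1) ^ n / (n + 1) *
        (∏ i ∈ Finset.range n, (2 * (i : ℚ) + 1)) / 2 ^ (n + 1) := by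
  have h := sum_coeff_descPochhammer_mul_bernoulli_sub n (1 / 2)
  rw [descPochhammer_succ_eval_half] at h
  calc _ = _ := Finset.sum_congr rfl fun k _ => ?_
    _ = _ := h
    _ = _ := by ring
  have hk := Polynomial.bernoulli_eval_half_add (k + 1)
  rw [eq_sub_of_add_eq hk, zpow_neg, zpow_natCast, one_div, inv_pow, pow_succ]
  field_simp
  ring
end

section
/- For every non-negative integer n and every real number y with 0 < y < n+1 such that y is not an integer, (1/(n+1)) · Γ(y+1) · Γ(n+1-y)/π = (1/sin((y-n)π)) · Σ_{k=0}^n s(n,k) · (B_{k+1}(y) - B_{k+1})/(k+1), where Γ is the Gamma function, s(n,k) are the (signed) Stirling numbers of the first kind, B_{k+1}(y) are the Bernoulli polynomials, and B_{k+1} = B_{k+1}(0) are the Bernoulli numbers. -/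
open Polynomial in
theorem sum_range_eval_descPochhammer (n N : ℕ) :
    (n + 1 : ℝ) * ∑ m ∈ Finset.range N, (descPochhammer ℝ n).eval (m : ℝ) =
      (descPochhammer ℝ (n + 1)).eval (N : ℝ) := by
  induction N with
  | zero => simp [descPochhammer_succ_left]
  | succ N ih =>
    have h := congrArg (Polynomial.eval (N + 1 : ℝ)) (descPochhammer_succ_comp_X_sub_one (R := ℝ) n)
    simp only [eval_comp, eval_sub, eval_X, eval_one, add_sub_cancel_right,
      smul_eq_mul] at h
    rw [Finset.sum_range_succ, mul_add, ih, h]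
    simp

theorem sum_range_pow_eq_aeval_bernoulli_sub (p N : ℕ) :
    ∑ m ∈ Finset.range N, (m : ℝ) ^ p =
      (Polynomial.aeval (N : ℝ) (Polynomial.bernoulli (p + 1)) -
        ((bernoulli (p + 1) : ℚ) : ℝ)) / (p + 1) := by
  have h := congrArg (Rat.cast : ℚ → ℝ) (Polynomial.sum_range_pow_eq_bernoulli_sub N p)
  have hp : (p + 1 : ℝ) ≠ 0 := by positivity
  have hN : Polynomial.aeval (N : ℝ) (Polynomial.bernoulli (p + 1)) =
      (((Polynomial.bernoulli (p + 1)).eval (N : ℚ) : ℚ) : ℝ) := by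
    simpa using Polynomial.aeval_algebraMap_apply ℝ (N : ℚ) (Polynomial.bernoulli (p + 1))
  rw [hN, eq_div_iff hp, mul_comm]
  simpa using h

/-- Indefinite summation of the falling factorial, expressed through Bernoulli polynomials. -/
theorem sum_coeff_descPochhammer_mul_bernoulli (n : ℕ) (y : ℝ) :
    ∑ k ∈ Finset.range (n + 1),
        (descPochhammer ℝ n).coeff k *
          (Polynomial.aeval y (Polynomial.bernoulli (k + 1)) -
            ((bernoulli (k + 1) : ℚ) : ℝ)) / (k + 1) =
      (descPochhammer ℝ (n + 1)).eval y / (n + 1) := by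
  let P : Polynomial ℝ := ∑ k ∈ Finset.range (n + 1),
    Polynomial.C ((descPochhammer ℝ n).coeff k / (k + 1)) *
      ((Polynomial.bernoulli (k + 1)).map (algebraMap ℚ ℝ) -
        Polynomial.C ((bernoulli (k + 1) : ℚ) : ℝ))
  let Q : Polynomial ℝ := Polynomial.C (n + 1 : ℝ)⁻¹ * descPochhammer ℝ (n + 1)
  have hP (x : ℝ) : P.eval x = ∑ k ∈ Finset.range (n + 1),
      (descPochhammer ℝ n).coeff k *
        (Polynomial.aeval x (Polynomial.bernoulli (k + 1)) -
          ((bernoulli (k + 1) : ℚ) : ℝ)) / (k + 1) := by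
    simp only [P, Polynomial.eval_finsetSum, Polynomial.eval_mul, Polynomial.eval_C,
      Polynomial.eval_sub, Polynomial.eval_map_algebraMap, div_mul_eq_mul_div]
  have hQ (x : ℝ) : Q.eval x = (descPochhammer ℝ (n + 1)).eval x / (n + 1) := by
    simp only [Q, Polynomial.eval_mul, Polynomial.eval_C, div_eq_inv_mul]
  have hPQ : P = Q := by
    refine Polynomial.eq_of_infinite_eval_eq P Q
      ((Set.infinite_range_of_injective (Nat.cast_injective (R := ℝ))).mono ?_)
    rintro _ ⟨N, rfl⟩
    have hn : (n + 1 : ℝ) ≠ 0 := by positivity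
    have hdeg : (descPochhammer ℝ n).natDegree = n := descPochhammer_natDegree ℝ n
    simp only [Set.mem_ofPred_eq]
    rw [hP, hQ, ← sum_range_eval_descPochhammer, mul_div_cancel_left₀ _ hn]
    simp only [Polynomial.eval_eq_sum_range, hdeg, mul_div_assoc,
      ← sum_range_pow_eq_aeval_bernoulli_sub, Finset.mul_sum]
    exact Finset.sum_comm
  rw [← hP, ← hQ, hPQ]

theorem Gamma_add_one_eq_descPochhammer_mul (y : ℝ) (hy : ∀ m : ℤ, y ≠ m) (k : ℕ) :
    Real.Gamma (y + 1) = (descPochhammer ℝ k).eval y * Real.Gamma (y + 1 - k) := by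
  induction k with
  | zero => simp
  | succ k ih =>
    have h := Real.Gamma_add_one (s := y - k) (sub_ne_zero.mpr (by exact_mod_cast hy k))
    rw [ih, descPochhammer_succ_eval, mul_assoc, show y + 1 - (k : ℝ) = y - k + 1 by ring, h]
    push_cast
    rw [add_sub_add_right_eq_sub]

/-- For every non-negative integer `n` and real `y` with `0 < y < n + 1` and `y`
not an integer,
`(1/(n+1)) · Γ(y+1) · Γ(n+1-y)/π
  = (1/sin((y-n)π)) · ∑_{k=0}^n s(n,k) · (B_{k+1}(y) - B_{k+1})/(k+1)`,
where `Γ` is the real Gamma function, `s(n,k)` is the signed Stirling number of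
the first kind, `B_{k+1}(y)` is the Bernoulli polynomial and
`B_{k+1} = B_{k+1}(0)` is the Bernoulli number. -/
theorem gamma_eq_stirling_bernoulli_sum (n : ℕ) (y : ℝ) (h0 : 0 < y)
    (h1 : y < n + 1) (hy : ∀ m : ℤ, y ≠ m) :
    1 / (n + 1) * Real.Gamma (y + 1) * Real.Gamma (n + 1 - y) / Real.pi =
      1 / Real.sin ((y - n) * Real.pi) *
        ∑ k ∈ Finset.range (n + 1),
          (descPochhammer ℝ n).coeff k *
            (Polynomial.aeval y (Polynomial.bernoulli (k + 1)) -
              ((bernoulli (k + 1) : ℚ) : ℝ)) / (k + 1) := by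
  rw [sum_coeff_descPochhammer_mul_bernoulli, Gamma_add_one_eq_descPochhammer_mul y hy (n + 1)]
  have h := Real.Gamma_mul_Gamma_one_sub (y - n)
  rw [show (1 : ℝ) - (y - n) = n + 1 - y by ring, mul_comm Real.pi] at h
  push_cast
  rw [add_sub_add_right_eq_sub, ← mul_assoc, mul_assoc, h]
  field_simp
end
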